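/- Let X → Y → Z → W → 0 be an exact sequence of cofinitely generated ℤ_p-modules with W finite. For such a module M, let M_div = ⋂_{n≥1} p^n M, its maximal p-divisible submodule, and M_{/div} = M/M_div. Then the induced sequence X_{/div} → Y_{/div} → Z_{/div} → W → 0 is exact. -/

import Mathlib

open PowerSeries

namespace IwasawaPaper

noncomputable section

/-! ## Generalities -/

/-- The inverse limit of an `ℕ`-indexed system of `R`-modules along transition maps
`t n : G (n+1) →ₗ[R] G n`, realized as a submodule of the product. -/
def invLim {R : Type} [CommRing R] (G : ℕ → Type) [∀ n, AddCommGroup (G n)]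
    [∀ n, Module R (G n)] (t : ∀ n, G (n + 1) →ₗ[R] G n) : Submodule R (∀ n, G n) where
  carrier := {x | ∀ n, t n (x (n + 1)) = x n}
  add_mem' := by
    intro a b ha hb n
    simp only [Pi.add_apply, map_add, ha n, hb n]
  zero_mem' := by
    intro n
    simp
  smul_mem' := by
    intro c x hx n
    simp only [Pi.smul_apply, map_smul, hx n]

/-- Transition maps `i ≤ j` obtained by iterating one-step maps `t n : G n →ₗ[R] G (n+1)`. -/
def chain {R : Type} [CommRing R] {G : ℕ → Type} [∀ n, AddCommGroup (G n)]
    [∀ n, Module R (G n)] (t : ∀ n, G n →ₗ[R] G (n + 1)) :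
    ∀ i j : ℕ, i ≤ j → (G i →ₗ[R] G j) := fun i _ h =>
  Nat.leRecOn (C := fun j => G i →ₗ[R] G j) h (fun {k} φ => (t k).comp φ) LinearMap.id

/-- The direct limit of an `ℕ`-indexed system of `R`-modules along one-step maps. -/
def dirLim {R : Type} [CommRing R] (G : ℕ → Type) [∀ n, AddCommGroup (G n)]
    [∀ n, Module R (G n)] (t : ∀ n, G n →ₗ[R] G (n + 1)) : Type :=
  Module.DirectLimit G (chain t)

instance {R : Type} [CommRing R] (G : ℕ → Type) [∀ n, AddCommGroup (G n)]
    [∀ n, Module R (G n)] (t : ∀ n, G n →ₗ[R] G (n + 1)) : AddCommGroup (dirLim G t) :=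
  inferInstanceAs (AddCommGroup (Module.DirectLimit G (chain t)))

instance {R : Type} [CommRing R] (G : ℕ → Type) [∀ n, AddCommGroup (G n)]
    [∀ n, Module R (G n)] (t : ∀ n, G n →ₗ[R] G (n + 1)) : Module R (dirLim G t) :=
  inferInstanceAs (Module R (Module.DirectLimit G (chain t)))

/-- The submodule of elements killed by some power of `r`. -/
def pTors (R : Type) [CommRing R] (r : R) (M : Type) [AddCommGroup M] [Module R M] :
    Submodule R M where
  carrier := {x | ∃ k : ℕ, r ^ k • x = 0}
  add_mem' := by
    rintro a b ⟨k, hk⟩ ⟨l, hl⟩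
    refine ⟨k + l, ?_⟩
    have ha : r ^ (k + l) • a = 0 := by rw [pow_add, mul_comm, mul_smul, hk, smul_zero]
    have hb : r ^ (k + l) • b = 0 := by rw [pow_add, mul_smul, hl, smul_zero]
    rw [smul_add, ha, hb, add_zero]
  zero_mem' := ⟨0, smul_zero _⟩
  smul_mem' := by
    rintro c x ⟨k, hk⟩
    exact ⟨k, by rw [← mul_smul, mul_comm, mul_smul, hk, smul_zero]⟩

lemma mem_pTors {R : Type} [CommRing R] {r : R} {M : Type} [AddCommGroup M] [Module R M]
    {x : M} : x ∈ pTors R r M ↔ ∃ k : ℕ, r ^ k • x = 0 := Iff.rfl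

/-- `Twist σ M` is `M` with the `R`-module structure twisted by `σ : R →+* R`. -/
def Twist {R : Type} [CommRing R] (σ : R →+* R) (M : Type) : Type := M

instance {R : Type} [CommRing R] (σ : R →+* R) (M : Type) [AddCommGroup M] :
    AddCommGroup (Twist σ M) := inferInstanceAs (AddCommGroup M)

instance {R : Type} [CommRing R] (σ : R →+* R) (M : Type) [AddCommGroup M] [Module R M] :
    Module R (Twist σ M) := Module.compHom M σ

/-- `PDual σ M N`: additive homomorphisms `M →+ N`, with `R`-action twisted by `σ`:
`(f • φ) m = φ (σ f • m)`. -/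
def PDual {R : Type} [CommRing R] (σ : R →+* R) (M : Type) [AddCommGroup M] [Module R M]
    (N : Type) [AddCommGroup N] : Type := M →+ N

namespace PDual

variable {R : Type} [CommRing R] (σ : R →+* R) (M : Type) [AddCommGroup M] [Module R M]
  (N : Type) [AddCommGroup N]

instance : AddCommGroup (PDual σ M N) := inferInstanceAs (AddCommGroup (M →+ N))

instance : FunLike (PDual σ M N) M N := inferInstanceAs (FunLike (M →+ N) M N)

instance : SMul R (PDual σ M N) :=
  ⟨fun f φ => ((φ : M →+ N).comp (DistribMulAction.toAddMonoidHom M (σ f)) : M →+ N)⟩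

lemma smul_apply (f : R) (φ : PDual σ M N) (m : M) : (f • φ) m = φ (σ f • m) := rfl

instance : Module R (PDual σ M N) where
  one_smul φ := by
    refine DFunLike.ext _ _ fun m => ?_
    rw [smul_apply, map_one, one_smul]
  mul_smul f g φ := by
    refine DFunLike.ext _ _ fun m => ?_
    rw [smul_apply, smul_apply, smul_apply, map_mul, mul_comm, mul_smul]
  smul_zero f := rfl
  smul_add f φ ψ := rfl
  add_smul f g φ := by
    refine DFunLike.ext _ _ fun m => ?_
    show φ (σ (f + g) • m) = φ (σ f • m) + φ (σ g • m)
    rw [map_add, add_smul]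
    exact (φ : M →+ N).map_add _ _
  zero_smul φ := by
    refine DFunLike.ext _ _ fun m => ?_
    show φ (σ 0 • m) = 0
    rw [map_zero, zero_smul]
    exact (φ : M →+ N).map_zero

end PDual

/-- `ℚ_p/ℤ_p`. -/
abbrev QZp (q : ℕ) [Fact (Nat.Prime q)] : Type :=
  ℚ_[q] ⧸ LinearMap.range (Algebra.linearMap ℤ_[q] ℚ_[q])

/-- A cofinitely generated `ℤ_p`-module: one isomorphic to `(ℚ_p/ℤ_p)^r × F` with `F` finite. -/
def CofinGenZp (q : ℕ) [Fact (Nat.Prime q)] (M : Type) [AddCommGroup M] [Module ℤ_[q] M] : Prop :=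
  ∃ (r : ℕ) (F : Submodule ℤ_[q] M), Finite F ∧ Nonempty (M ≃ₗ[ℤ_[q]] ((Fin r → QZp q) × F))

/-- The maximal `p`-divisible submodule `⋂_{n ≥ 1} pⁿ M` of a `ℤ_p`-module. -/
def pDivPart (q : ℕ) [Fact (Nat.Prime q)] (M : Type) [AddCommGroup M] [Module ℤ_[q] M] :
    Submodule ℤ_[q] M :=
  ⨅ n : ℕ, LinearMap.range (LinearMap.lsmul ℤ_[q] M ((q : ℤ_[q]) ^ (n + 1)))

/-- `rank_{ℤ_p} N = dim_{ℚ_p} (N ⊗ ℚ_p)`. -/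
def rankZp (q : ℕ) [Fact (Nat.Prime q)] (N : Type) [AddCommGroup N] [Module ℤ_[q] N] : ℕ :=
  Module.finrank ℚ_[q] (TensorProduct ℤ_[q] ℚ_[q] N)

/-- `Q(R)/R`. -/
abbrev QmodR (R : Type) [CommRing R] : Type :=
  FractionRing R ⧸ LinearMap.range (Algebra.linearMap R (FractionRing R))

/-- `rank_R N = dim_{Q(R)} (N ⊗_R Q(R))`, as a natural number. -/
def rankOver (R : Type) [CommRing R] [IsDomain R] (N : Type) [AddCommGroup N] [Module R N] : ℕ :=
  Module.finrank (FractionRing R) (TensorProduct R (FractionRing R) N)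

/-! ## The Iwasawa algebra set-up -/

variable (p : ℕ) (W : Type) [CommRing W]

/-- `ωₙ = (1+T)^(p^(n-1)) - 1`. -/
def om (n : ℕ) : PowerSeries W := (1 + X) ^ p ^ (n - 1) - 1

/-- `ω_{n+1,n} = ω_{n+1}/ωₙ`, as an explicit geometric sum. -/
def omQ (n : ℕ) : PowerSeries W := ∑ i ∈ Finset.range p, ((1 + X : PowerSeries W) ^ p ^ (n - 1)) ^ i

lemma om_dvd_succ (n : ℕ) : om p W n ∣ om p W (n + 1) := by
  cases n with
  | zero => exact dvd_refl _
  | succ m =>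
    have h := sub_dvd_pow_sub_pow ((1 + X : PowerSeries W) ^ p ^ m) 1 p
    simpa [om, one_pow, ← pow_mul, ← pow_succ] using h

lemma omQ_mul_om (n : ℕ) :
    omQ p W n * om p W n = (1 + X : PowerSeries W) ^ (p ^ (n - 1) * p) - 1 := by
  have h := geom_sum_mul ((1 + X : PowerSeries W) ^ p ^ (n - 1)) p
  simpa [om, omQ, ← pow_mul] using h

lemma om_succ_dvd (n : ℕ) : om p W (n + 1) ∣ om p W n * omQ p W n := by
  rw [mul_comm, omQ_mul_om]
  cases n with
  | zero =>
    have h := sub_dvd_pow_sub_pow (1 + X : PowerSeries W) 1 p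
    have e : (1 + X : PowerSeries W) - 1 = X := by ring
    rw [e, one_pow] at h
    simpa [om, pow_zero, pow_one, one_mul, e] using h
  | succ m =>
    have h : p ^ (m + 1 - 1) * p = p ^ (m + 1 + 1 - 1) := by
      simp [pow_succ]
    rw [h]
    exact dvd_of_eq rfl

variable (M : Type) [AddCommGroup M] [Module (PowerSeries W) M]

/-- `M[f]`, the kernel of multiplication by `f` on `M`. -/
def kerSmul (f : PowerSeries W) : Submodule (PowerSeries W) M :=
  LinearMap.ker (LinearMap.lsmul (PowerSeries W) M f)

/-- `fM`, the image of multiplication by `f` on `M`. -/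
def smulRange (f : PowerSeries W) : Submodule (PowerSeries W) M :=
  LinearMap.range (LinearMap.lsmul (PowerSeries W) M f)

/-- `M/ωₙM`. -/
def omQuot (n : ℕ) : Type := M ⧸ smulRange W M (om p W n)

instance (n : ℕ) : AddCommGroup (omQuot p W M n) :=
  inferInstanceAs (AddCommGroup (M ⧸ smulRange W M (om p W n)))

instance (n : ℕ) : Module (PowerSeries W) (omQuot p W M n) :=
  inferInstanceAs (Module (PowerSeries W) (M ⧸ smulRange W M (om p W n)))

/-- Natural projection `M/ω_{n+1}M → M/ωₙM`. -/
def omProj (n : ℕ) : omQuot p W M (n + 1) →ₗ[PowerSeries W] omQuot p W M n :=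
  Submodule.mapQ _ _ LinearMap.id (by
    rintro _ ⟨y, rfl⟩
    obtain ⟨c, hc⟩ := om_dvd_succ p W n
    refine ⟨c • y, ?_⟩
    simp only [LinearMap.lsmul_apply, LinearMap.id_coe, id_eq]
    rw [smul_smul, ← hc])

/-- The canonical map `M → lim_n M/ωₙM`. -/
def toInvLim : M →ₗ[PowerSeries W] invLim (fun n => omQuot p W M n) (omProj p W M) :=
  LinearMap.codRestrict _ (LinearMap.pi fun n => (smulRange W M (om p W n)).mkQ)
    (by
      intro x n
      show omProj p W M n (Submodule.Quotient.mk x) = Submodule.Quotient.mk x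
      rfl)

/-- The norm map `M[ω_{n+1}] → M[ωₙ]`, multiplication by `ω_{n+1,n}`. -/
def omNorm (n : ℕ) : kerSmul W M (om p W (n + 1)) →ₗ[PowerSeries W] kerSmul W M (om p W n) :=
  LinearMap.restrict (LinearMap.lsmul (PowerSeries W) M (omQ p W n)) (by
    intro x hx
    obtain ⟨c, hc⟩ := om_succ_dvd p W n
    simp only [kerSmul, LinearMap.mem_ker, LinearMap.lsmul_apply] at hx ⊢
    rw [smul_smul, hc, mul_comm, mul_smul, hx, smul_zero])

/-- The map `M/ωₙM → M/ω_{n+1}M` induced by multiplication by `ω_{n+1,n}`. -/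
def omColMap (n : ℕ) : omQuot p W M n →ₗ[PowerSeries W] omQuot p W M (n + 1) :=
  Submodule.mapQ _ _ (LinearMap.lsmul (PowerSeries W) M (omQ p W n)) (by
    rintro _ ⟨y, rfl⟩
    obtain ⟨c, hc⟩ := om_succ_dvd p W n
    refine ⟨c • y, ?_⟩
    simp only [LinearMap.lsmul_apply]
    rw [smul_smul, smul_smul, mul_comm (omQ p W n) (om p W n), hc])

/-- `(M/ωₙM)[p^∞]`. -/
def omQuotPT (n : ℕ) : Submodule (PowerSeries W) (omQuot p W M n) :=
  pTors (PowerSeries W) ((p : PowerSeries W)) (omQuot p W M n)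

/-- Transition maps of the inverse system `(M/ωₙM)[p^∞]` (natural projections). -/
def Gmap (n : ℕ) : omQuotPT p W M (n + 1) →ₗ[PowerSeries W] omQuotPT p W M n :=
  (omProj p W M n).restrict (fun x hx => by
    obtain ⟨k, hk⟩ := hx
    exact ⟨k, by rw [← map_smul, hk, map_zero]⟩)

/-- Transition maps of the direct system `(M/ωₙM)[p^∞]` (multiplication by `ω_{n+1,n}`). -/
def Fmap (n : ℕ) : omQuotPT p W M n →ₗ[PowerSeries W] omQuotPT p W M (n + 1) :=
  (omColMap p W M n).restrict (fun x hx => by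
    obtain ⟨k, hk⟩ := hx
    exact ⟨k, by rw [← map_smul, hk, map_zero]⟩)

/-- `𝔊(M) = lim_n (M/ωₙM)[p^∞]`. -/
def GG : Submodule (PowerSeries W) (∀ n, omQuotPT p W M n) :=
  invLim (fun n => omQuotPT p W M n) (Gmap p W M)

/-- `colim_n (M/ωₙM)[p^∞]`. -/
def FColim : Type := dirLim (fun n => omQuotPT p W M n) (Fmap p W M)

instance : AddCommGroup (FColim p W M) :=
  inferInstanceAs (AddCommGroup (dirLim (fun n => omQuotPT p W M n) (Fmap p W M)))

instance : Module (PowerSeries W) (FColim p W M) :=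
  inferInstanceAs (Module (PowerSeries W) (dirLim (fun n => omQuotPT p W M n) (Fmap p W M)))

/-- `𝔉(M) = (colim_n (M/ωₙM)[p^∞])^∨`, with the `Λ`-action twisted by `ι`. -/
def FF [Fact (Nat.Prime p)] (ι : PowerSeries W →ₐ[W] PowerSeries W) : Type :=
  PDual ι.toRingHom (FColim p W M) (QZp p)

instance [Fact (Nat.Prime p)] (ι : PowerSeries W →ₐ[W] PowerSeries W) :
    AddCommGroup (FF p W M ι) :=
  inferInstanceAs (AddCommGroup (PDual ι.toRingHom (FColim p W M) (QZp p)))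

instance [Fact (Nat.Prime p)] (ι : PowerSeries W →ₐ[W] PowerSeries W) :
    Module (PowerSeries W) (FF p W M ι) :=
  inferInstanceAs (Module (PowerSeries W) (PDual ι.toRingHom (FColim p W M) (QZp p)))

end

end IwasawaPaper

namespace IwasawaPaper

theorem mem_pDivPart {q : ℕ} [Fact (Nat.Prime q)] {M : Type} [AddCommGroup M]
    [Module ℤ_[q] M] {x : M} :
    x ∈ pDivPart q M ↔ ∀ n : ℕ, ∃ y : M, (q : ℤ_[q]) ^ (n + 1) • y = x := by
  simp [pDivPart, Submodule.mem_iInf]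

theorem exists_pow_smul_eq_of_mem_pDivPart {q : ℕ} [Fact (Nat.Prime q)] {M : Type}
    [AddCommGroup M] [Module ℤ_[q] M] {x : M} (hx : x ∈ pDivPart q M) (n : ℕ) :
    ∃ y : M, (q : ℤ_[q]) ^ n • y = x := by
  obtain ⟨y, hy⟩ := mem_pDivPart.1 hx n
  exact ⟨(q : ℤ_[q]) • y, by rw [smul_smul, ← pow_succ, hy]⟩

theorem pDivPart_le_comap {q : ℕ} [Fact (Nat.Prime q)] {M N : Type} [AddCommGroup M]
    [AddCommGroup N] [Module ℤ_[q] M] [Module ℤ_[q] N] (f : M →ₗ[ℤ_[q]] N) :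
    pDivPart q M ≤ (pDivPart q N).comap f := fun x hx =>
  mem_pDivPart.2 fun n => by
    obtain ⟨y, rfl⟩ := mem_pDivPart.1 hx n
    exact ⟨f y, (map_smul _ _ _).symm⟩

theorem exists_pow_smul_eq_zero_of_finite (q : ℕ) [Fact (Nat.Prime q)] (M : Type)
    [AddCommGroup M] [Module ℤ_[q] M] [Finite M] :
    ∃ k : ℕ, ∀ x : M, (q : ℤ_[q]) ^ k • x = 0 := by
  have hcard : ((Nat.card M : ℕ) : ℤ_[q]) ≠ 0 := Nat.cast_ne_zero.2 Nat.card_pos.ne'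
  refine ⟨(Nat.card M : ℤ_[q]).valuation, fun x => ?_⟩
  have hx : (Nat.card M : ℤ_[q]) • x = 0 := by
    rw [Nat.cast_smul_eq_nsmul, card_nsmul_eq_zero']
  rw [PadicInt.unitCoeff_spec hcard, mul_smul] at hx
  exact (PadicInt.unitCoeff hcard).isUnit.smul_eq_zero.1 hx

theorem exists_pow_smul_eq_QZp {q : ℕ} [Fact (Nat.Prime q)] (n : ℕ) (x : QZp q) :
    ∃ y : QZp q, (q : ℤ_[q]) ^ n • y = x := by
  obtain ⟨x, rfl⟩ := Submodule.Quotient.mk_surjective _ x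
  have hq : (q : ℚ_[q]) ≠ 0 := Nat.cast_ne_zero.2 (Fact.out : Nat.Prime q).ne_zero
  refine ⟨Submodule.Quotient.mk (((q : ℚ_[q]) ^ n)⁻¹ * x), ?_⟩
  rw [← Submodule.Quotient.mk_smul, Algebra.smul_def]
  simp [hq]

/-- A power of `q` maps a cofinitely generated module into its divisible part. -/
theorem CofinGenZp.exists_pow_smul_mem_pDivPart {q : ℕ} [Fact (Nat.Prime q)] {M : Type}
    [AddCommGroup M] [Module ℤ_[q] M] (hM : CofinGenZp q M) :
    ∃ k : ℕ, ∀ x : M, (q : ℤ_[q]) ^ k • x ∈ pDivPart q M := by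
  obtain ⟨r, F, hF, ⟨e⟩⟩ := hM
  obtain ⟨k, hk⟩ := exists_pow_smul_eq_zero_of_finite q F
  refine ⟨k, fun x => mem_pDivPart.2 fun n => ?_⟩
  choose y hy using fun i => exists_pow_smul_eq_QZp (n + 1) ((q : ℤ_[q]) ^ k • (e x).1 i)
  refine ⟨e.symm (y, 0), e.injective ?_⟩
  rw [map_smul, map_smul, e.apply_symm_apply]
  ext1
  · exact funext hy
  · simp [hk]

theorem pDivPart_le_ker_of_finite {q : ℕ} [Fact (Nat.Prime q)] {M N : Type} [AddCommGroup M]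
    [AddCommGroup N] [Module ℤ_[q] M] [Module ℤ_[q] N] [Finite N] (f : M →ₗ[ℤ_[q]] N) :
    pDivPart q M ≤ LinearMap.ker f := fun x hx => by
  obtain ⟨k, hk⟩ := exists_pow_smul_eq_zero_of_finite q N
  obtain ⟨y, rfl⟩ := exists_pow_smul_eq_of_mem_pDivPart hx k
  rw [LinearMap.mem_ker, map_smul, hk]

/-- A linear map with finite cokernel from a cofinitely generated module is surjective on
divisible parts. -/
theorem CofinGenZp.pDivPart_le_map {q : ℕ} [Fact (Nat.Prime q)] {B C D : Type}
    [AddCommGroup B] [AddCommGroup C] [AddCommGroup D] [Module ℤ_[q] B] [Module ℤ_[q] C]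
    [Module ℤ_[q] D] [Finite D] (hB : CofinGenZp q B) (g : B →ₗ[ℤ_[q]] C) (h : C →ₗ[ℤ_[q]] D)
    (hgh : LinearMap.ker h = LinearMap.range g) :
    pDivPart q C ≤ (pDivPart q B).map g := fun c hc => by
  obtain ⟨k, hk⟩ := hB.exists_pow_smul_mem_pDivPart
  obtain ⟨m, hm⟩ := exists_pow_smul_eq_zero_of_finite q D
  obtain ⟨c', rfl⟩ := exists_pow_smul_eq_of_mem_pDivPart hc (k + m)
  have hc' : (q : ℤ_[q]) ^ m • c' ∈ LinearMap.range g := by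
    rw [← hgh, LinearMap.mem_ker, map_smul, hm]
  obtain ⟨b, hb⟩ := hc'
  exact ⟨_, hk b, by rw [map_smul, hb, smul_smul, pow_add]⟩

theorem statement6 (p : ℕ) [Fact (Nat.Prime p)]
    (A B C D : Type) [AddCommGroup A] [AddCommGroup B] [AddCommGroup C] [AddCommGroup D]
    [Module ℤ_[p] A] [Module ℤ_[p] B] [Module ℤ_[p] C] [Module ℤ_[p] D]
    (hA : CofinGenZp p A) (hB : CofinGenZp p B) (hC : CofinGenZp p C) (hD : CofinGenZp p D)
    [Finite D]
    (f : A →ₗ[ℤ_[p]] B) (g : B →ₗ[ℤ_[p]] C) (h : C →ₗ[ℤ_[p]] D)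
    (hBex : LinearMap.ker g = LinearMap.range f)
    (hCex : LinearMap.ker h = LinearMap.range g)
    (hsurj : Function.Surjective h) :
    ∃ (h1 : pDivPart p A ≤ (pDivPart p B).comap f)
      (h2 : pDivPart p B ≤ (pDivPart p C).comap g)
      (h3 : pDivPart p C ≤ LinearMap.ker h),
      LinearMap.ker (Submodule.mapQ (pDivPart p B) (pDivPart p C) g h2) =
        LinearMap.range (Submodule.mapQ (pDivPart p A) (pDivPart p B) f h1) ∧
      LinearMap.ker ((pDivPart p C).liftQ h h3) =
        LinearMap.range (Submodule.mapQ (pDivPart p B) (pDivPart p C) g h2) ∧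
      Function.Surjective ((pDivPart p C).liftQ h h3) := by
  refine ⟨pDivPart_le_comap f, pDivPart_le_comap g, pDivPart_le_ker_of_finite h, ?_, ?_, ?_⟩
  · rw [Submodule.ker_mapQ, Submodule.range_mapQ, ← hBex]
    refine le_antisymm ?_ (Submodule.map_mono fun b hb => ?_)
    · rintro _ ⟨b, hb, rfl⟩
      obtain ⟨b', hb', hbb'⟩ := hB.pDivPart_le_map g h hCex hb
      refine ⟨b - b', ?_, ?_⟩
      · simp [hbb']
      · simpa using hb'
    · rw [Submodule.mem_comap, LinearMap.mem_ker.1 hb]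
      exact zero_mem _
  · rw [Submodule.ker_liftQ, Submodule.range_mapQ, hCex]
  · intro d
    obtain ⟨c, rfl⟩ := hsurj d
    exact ⟨Submodule.Quotient.mk c, Submodule.liftQ_apply _ _ _⟩

end IwasawaPaper
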